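/- Let Q be a free-connex acyclic conjunctive query and 𝒱 a finite set of conjunctive-query views. If Q is 𝒱-rewritable, then there is a free-connex acyclic 𝒱-rewriting of Q. -/

import Mathlib

/-- A relational atom (or fact): a relation symbol with a list of arguments.
Arguments are natural numbers, serving both as variables and as data values. -/
structure Atom where
  rel : ℕ
  args : List ℕ
deriving DecidableEq

/-- Apply a substitution to an atom. -/
def mapAtom (f : ℕ → ℕ) (A : Atom) : Atom := ⟨A.rel, A.args.map f⟩

/-- The variables of an atom. -/
def Atom.vars (A : Atom) : Finset ℕ := A.args.toFinset

/-- The variables of a finite set of atoms. -/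
def varsOf (B : Finset Atom) : Finset ℕ := B.biUnion Atom.vars

/-- A conjunctive query: a head atom and a finite set of body atoms. -/
structure CQ where
  head : Atom
  body : Finset Atom
deriving DecidableEq

/-- All variables of a conjunctive query. -/
def CQ.vars (Q : CQ) : Finset ℕ := Q.head.vars ∪ varsOf Q.body

/-- A schema: a set of relation symbols together with an arity function. -/
structure Schema where
  rels : Set ℕ
  ar : ℕ → ℕ

/-- An atom (or fact) over a schema. -/
def atomOver (σ : Schema) (A : Atom) : Prop :=
  A.rel ∈ σ.rels ∧ A.args.length = σ.ar A.rel

/-- `Q` is a (well-formed) conjunctive query over schema `σ`: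
nonempty body of σ-atoms, head relation symbol not in σ, and safety. -/
def isCQ (σ : Schema) (Q : CQ) : Prop :=
  Q.body.Nonempty ∧ (∀ A ∈ Q.body, atomOver σ A) ∧
  Q.head.rel ∉ σ.rels ∧ Q.head.vars ⊆ varsOf Q.body

/-- A database is a set of facts (finiteness is imposed where needed). -/
abbrev Database := Set Atom

/-- A database over a schema. -/
def isDBOver (σ : Schema) (D : Database) : Prop := ∀ F ∈ D, atomOver σ F

/-- The result of a conjunctive query on a database. -/
def evalCQ (Q : CQ) (D : Database) : Set Atom :=
  { F | ∃ ν : ℕ → ℕ, (∀ A ∈ Q.body, mapAtom ν A ∈ D) ∧ mapAtom ν Q.head = F }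

/-- Containment of conjunctive queries. -/
def containedCQ (Q1 Q2 : CQ) : Prop :=
  ∀ D : Database, D.Finite → evalCQ Q1 D ⊆ evalCQ Q2 D

/-- Equivalence of conjunctive queries. -/
def equivCQ (Q1 Q2 : CQ) : Prop :=
  ∀ D : Database, D.Finite → evalCQ Q1 D = evalCQ Q2 D

/-- A conjunctive query is minimal if no equivalent CQ has strictly fewer body atoms. -/
def isMinimal (Q : CQ) : Prop :=
  ∀ Q2 : CQ, equivCQ Q Q2 → Q.body.card ≤ Q2.body.card

/-- A homomorphism from `Q2` to `Q1`. -/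
def isHom (h : ℕ → ℕ) (Q2 Q1 : CQ) : Prop :=
  (∀ A ∈ Q2.body, mapAtom h A ∈ Q1.body) ∧ mapAtom h Q2.head = Q1.head

/-- A body homomorphism from `Q2` to `Q1`. -/
def isBodyHom (h : ℕ → ℕ) (Q2 Q1 : CQ) : Prop :=
  ∀ A ∈ Q2.body, mapAtom h A ∈ Q1.body

/-- A set of views over σ: each view is a CQ over σ and views have
pairwise distinct head relation symbols. -/
def isViewSet (σ : Schema) (𝒱 : Finset CQ) : Prop :=
  (∀ V ∈ 𝒱, isCQ σ V) ∧
  ∀ V ∈ 𝒱, ∀ W ∈ 𝒱, V ≠ W → V.head.rel ≠ W.head.rel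

/-- The 𝒱-defined database 𝒱(D). -/
def viewDB (𝒱 : Finset CQ) (D : Database) : Database :=
  ⋃ V ∈ 𝒱, evalCQ V D

/-- `Q'` is a CQ over the schema σ_𝒱 of the head relations of the views 𝒱. -/
def overViews (𝒱 : Finset CQ) (Q' : CQ) : Prop :=
  Q'.body.Nonempty ∧
  (∀ A ∈ Q'.body, ∃ V ∈ 𝒱, A.rel = V.head.rel ∧ A.args.length = V.head.args.length) ∧
  (∀ V ∈ 𝒱, Q'.head.rel ≠ V.head.rel) ∧
  Q'.head.vars ⊆ varsOf Q'.body

/-- `Q'` is a 𝒱-rewriting of `Q`: `Q'` is over σ_𝒱 and `Q'(𝒱(D)) = Q(D)`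
for every (finite) database `D` over σ. -/
def isRewriting (σ : Schema) (𝒱 : Finset CQ) (Q Q' : CQ) : Prop :=
  overViews 𝒱 Q' ∧
  ∀ D : Database, D.Finite → isDBOver σ D →
    evalCQ Q' (viewDB 𝒱 D) = evalCQ Q D

/-- `T` is a join tree for the atom set `B`. -/
def joinTreeProp (B : Finset Atom) (T : SimpleGraph {A : Atom // A ∈ B}) : Prop :=
  T.IsTree ∧
  ∀ (x : ℕ) (A A' : {A : Atom // A ∈ B}) (p : T.Walk A A'), p.IsPath →
    x ∈ A.1.vars → x ∈ A'.1.vars → ∀ C ∈ p.support, x ∈ C.1.vars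

/-- The atom set `B` has a join tree. -/
def hasJoinTree (B : Finset Atom) : Prop :=
  ∃ T : SimpleGraph {A : Atom // A ∈ B}, joinTreeProp B T

/-- A conjunctive query is acyclic if its body has a join tree. -/
def isAcyclicCQ (Q : CQ) : Prop := hasJoinTree Q.body

/-- A conjunctive query is free-connex acyclic. -/
def isFreeConnex (Q : CQ) : Prop :=
  isAcyclicCQ Q ∧ hasJoinTree (insert Q.head Q.body)

/-- The bridge variables of `𝒜 ⊆ body(Q)`. -/
def bvars (Q : CQ) (𝒜 : Finset Atom) : Finset ℕ :=
  varsOf 𝒜 ∩ (Q.head.vars ∪ varsOf (Q.body \ 𝒜))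

/-- An application of a view `V`: a substitution that does not unify any
quantified variable of `V` with another variable of `V`. -/
def isApplication (V : CQ) (α : ℕ → ℕ) : Prop :=
  ∀ x ∈ varsOf V.body, x ∉ V.head.vars →
    ∀ y ∈ CQ.vars V, y ≠ x → α x ≠ α y

/-- The query α(V). -/
def applyCQ (α : ℕ → ℕ) (V : CQ) : CQ :=
  ⟨mapAtom α V.head, V.body.image (mapAtom α)⟩

/-- `(𝒜, V, α, ψ)` is a cover description for `Q`. -/
def isCoverDesc (Q : CQ) (𝒜 : Finset Atom) (V : CQ) (α ψ : ℕ → ℕ) : Prop :=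
  𝒜 ⊆ Q.body ∧ isApplication V α ∧
  𝒜 ⊆ V.body.image (mapAtom α) ∧
  bvars Q 𝒜 ⊆ V.head.vars.image α ∧
  isBodyHom ψ (applyCQ α V) Q ∧
  ∀ x ∈ varsOf 𝒜, ψ x = x

/-- A cover partition for `Q` over `𝒱`: a collection of cover descriptions
whose atom sets partition `body(Q)`. -/
def isCoverPartition (Q : CQ) (𝒱 : Finset CQ) (m : ℕ)
    (𝒜 : Fin m → Finset Atom) (V : Fin m → CQ) (α ψ : Fin m → ℕ → ℕ) : Prop :=
  (∀ i, V i ∈ 𝒱 ∧ isCoverDesc Q (𝒜 i) (V i) (α i) (ψ i)) ∧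
  ∀ A ∈ Q.body, ∃! i, A ∈ 𝒜 i

/-- Consistency of a cover partition: a variable of any `α_j(V_j)` lies in the
range of another `α_i` only if it also lies in `bvars(𝒜_j)`. -/
def isConsistent (Q : CQ) (m : ℕ) (𝒜 : Fin m → Finset Atom) (V : Fin m → CQ)
    (α : Fin m → ℕ → ℕ) : Prop :=
  ∀ i j : Fin m, i ≠ j → ∀ z ∈ CQ.vars (applyCQ (α j) (V j)),
    (∃ x ∈ CQ.vars (V i), α i x = z) → z ∈ bvars Q (𝒜 j)

/-- The query `Q_𝒞` induced by a (consistent) cover partition. -/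
def inducedCQ (Q : CQ) (m : ℕ) (V : Fin m → CQ) (α : Fin m → ℕ → ℕ) : CQ :=
  ⟨Q.head, Finset.image (fun i => mapAtom (α i) (V i).head) Finset.univ⟩

/-- Quantified variable disjointness for a family of view applications. -/
def QVD (m : ℕ) (V : Fin m → CQ) (α : Fin m → ℕ → ℕ) : Prop :=
  ∀ i j : Fin m, i ≠ j → ∀ x ∈ varsOf (V i).body, x ∉ (V i).head.vars →
    ∀ y ∈ CQ.vars (V j), α i x ≠ α j y

/-- `QE` is an expansion of `Q'` with respect to the views `𝒱`. -/
def isExpansion (𝒱 : Finset CQ) (Q' QE : CQ) : Prop :=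
  ∃ (m : ℕ) (A' : Fin m → Atom) (V : Fin m → CQ) (α : Fin m → ℕ → ℕ),
    (∀ i, V i ∈ 𝒱 ∧ isApplication (V i) (α i) ∧ A' i = mapAtom (α i) (V i).head) ∧
    Q'.body = Finset.image A' Finset.univ ∧
    QVD m V α ∧
    QE.head = Q'.head ∧
    QE.body = Finset.biUnion Finset.univ (fun i => (V i).body.image (mapAtom (α i)))

/-- `atoms(x)`: the body atoms of `Q` containing the variable `x`. -/
def atomsWith (Q : CQ) (x : ℕ) : Finset Atom :=
  Q.body.filter (fun A => x ∈ A.vars)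

/-- Hierarchical conjunctive queries. -/
def isHierarchical (Q : CQ) : Prop :=
  ∀ x y : ℕ, atomsWith Q x ⊆ atomsWith Q y ∨ atomsWith Q y ⊆ atomsWith Q x ∨
    atomsWith Q x ∩ atomsWith Q y = ∅

/-- q-hierarchical conjunctive queries. -/
def isQHierarchical (Q : CQ) : Prop :=
  isHierarchical Q ∧ ∀ x y : ℕ, atomsWith Q x ⊂ atomsWith Q y →
    x ∈ Q.head.vars → y ∈ Q.head.vars

/-- `P` is a partition of `body(Q)` witnessing weak head arity at most `k`. -/
def witnessesWHA (Q : CQ) (k n : ℕ) (P : Fin n → Finset Atom) : Prop :=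
  (∀ i, (P i).Nonempty) ∧ (∀ i, P i ⊆ Q.body) ∧ (∀ A ∈ Q.body, ∃! i, A ∈ P i) ∧
  (∀ i, (varsOf (P i) ∩ Q.head.vars).card ≤ k) ∧
  (∀ i j, i ≠ j → ∀ x ∈ varsOf (P i), x ∈ varsOf (P j) → x ∈ Q.head.vars)

/-- `Q` has weak head arity at most `k`. -/
def hasWHAle (Q : CQ) (k : ℕ) : Prop := ∃ n P, witnessesWHA Q k n P

/-- The weak head arity of `Q`. -/
noncomputable def weakHeadArity (Q : CQ) : ℕ := sInf {k | hasWHAle Q k}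

/-- The cover graph of `Q`: vertices are the body atoms, with an edge between
two atoms iff they share a variable not occurring in the head. -/
def coverGraph (Q : CQ) : SimpleGraph {A : Atom // A ∈ Q.body} :=
  SimpleGraph.fromRel (fun A B => ∃ x, x ∈ A.1.vars ∧ x ∈ B.1.vars ∧ x ∉ Q.head.vars)

/-- A subset `s` of the atom set `B` is connected in the (join) tree `T`. -/
def connectedIn (B : Finset Atom) (T : SimpleGraph {A : Atom // A ∈ B}) (s : Finset Atom) : Prop :=
  (T.induce {A : {A : Atom // A ∈ B} | A.1 ∈ s}).Connected

/-- `a` and `b` are joined by a walk of `T` that stays in `S`. -/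
def WalkIn {ι : Type*} (T : SimpleGraph ι) (S : Set ι) (a b : ι) : Prop :=
  ∃ p : T.Walk a b, ∀ c ∈ p.support, c ∈ S

section WalkIn

variable {ι : Type*} {T : SimpleGraph ι} {S S' : Set ι} {a b c : ι}

lemma WalkIn.refl (ha : a ∈ S) : WalkIn T S a a :=
  ⟨SimpleGraph.Walk.nil, by simpa using ha⟩

lemma WalkIn.symm (h : WalkIn T S a b) : WalkIn T S b a := by
  obtain ⟨p, hp⟩ := h
  exact ⟨p.reverse, by simpa using hp⟩

lemma WalkIn.trans (h : WalkIn T S a b) (h' : WalkIn T S b c) : WalkIn T S a c := by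
  obtain ⟨p, hp⟩ := h
  obtain ⟨q, hq⟩ := h'
  refine ⟨p.append q, fun d hd => ?_⟩
  rw [SimpleGraph.Walk.mem_support_append_iff] at hd
  exact hd.elim (hp d) (hq d)

lemma WalkIn.mono (h : WalkIn T S a b) (hS : S ⊆ S') : WalkIn T S' a b := by
  obtain ⟨p, hp⟩ := h
  exact ⟨p, fun d hd => hS (hp d hd)⟩

lemma WalkIn.of_adj (h : T.Adj a b) (ha : a ∈ S) (hb : b ∈ S) : WalkIn T S a b :=
  ⟨h.toWalk, by simp [ha, hb]⟩

lemma WalkIn.map {κ : Type*} {U : SimpleGraph κ} {S' : Set κ} (f : T →g U)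
    (h : WalkIn T S a b) (hS : ∀ i ∈ S, f i ∈ S') : WalkIn U S' (f a) (f b) := by
  obtain ⟨p, hp⟩ := h
  refine ⟨p.map f, fun d hd => ?_⟩
  rw [SimpleGraph.Walk.support_map, List.mem_map] at hd
  obtain ⟨e, he, rfl⟩ := hd
  exact hS e (hp e he)

/-- In an acyclic graph, a path stays inside every set that contains some walk with the same
endpoints. -/
lemma WalkIn.mem_of_isPath (hT : T.IsAcyclic) (h : WalkIn T S a b) (p : T.Walk a b)
    (hp : p.IsPath) (hc : c ∈ p.support) : c ∈ S := by
  classical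
  obtain ⟨q, hq⟩ := h
  have := (hT.subsingleton_path a b).elim ⟨p, hp⟩ q.toPath
  have h2 : p = q.bypass := congrArg Subtype.val this
  subst h2
  exact hq c (q.support_bypass_subset_support hc)

end WalkIn

/-- `T` is a tree in which, for each `x`, the vertices whose bag contains `x` are connected. -/
def IsTreeDecomp {ι : Type*} (T : SimpleGraph ι) (χ : ι → Finset ℕ) : Prop :=
  T.IsTree ∧ ∀ x a b, x ∈ χ a → x ∈ χ b → WalkIn T {i | x ∈ χ i} a b

lemma joinTreeProp_iff (B : Finset Atom) (T : SimpleGraph {A : Atom // A ∈ B}) :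
    joinTreeProp B T ↔ IsTreeDecomp T (fun A => A.1.vars) := by
  refine and_congr_right fun hT => ⟨fun h x a b ha hb => ?_, fun h x a b p hp ha hb c hc => ?_⟩
  · obtain ⟨p, hp, -⟩ := hT.existsUnique_path a b
    exact ⟨p, fun c hc => h x a b p hp ha hb c hc⟩
  · exact (h x a b ha hb).mem_of_isPath (c := c) hT.isAcyclic p hp hc

/-- Lists of sets with the running intersection property. -/
inductive RunningIntersection : List (Finset ℕ) → Prop
  | single (e : Finset ℕ) : RunningIntersection [e]
  | cons (e f : Finset ℕ) (l : List (Finset ℕ)) : RunningIntersection l → f ∈ l →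
      (∀ x ∈ e, ∀ g ∈ l, x ∈ g → x ∈ f) → RunningIntersection (e :: l)

lemma isTreeDecomp_induce_leaf {ι : Type*} [Finite ι] [Nontrivial ι] {T : SimpleGraph ι}
    {χ : ι → Finset ℕ} (h : IsTreeDecomp T χ) :
    ∃ v w : ι, v ≠ w ∧ (∀ u, u ≠ v → ∀ x ∈ χ v, x ∈ χ u → x ∈ χ w) ∧
      IsTreeDecomp (T.induce {v}ᶜ) (fun i => χ i.1) := by
  classical
  have := Fintype.ofFinite ι
  obtain ⟨hT, hχ⟩ := h
  obtain ⟨v, hv⟩ := hT.exists_vert_degree_one_of_nontrivial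
  have htree : (T.induce {v}ᶜ).IsTree :=
    ⟨hT.1.induce_compl_singleton_of_degree_eq_one hv, hT.isAcyclic.induce _⟩
  obtain ⟨w, hw, huniq⟩ := SimpleGraph.degree_eq_one_iff_existsUnique_adj.1 hv
  refine ⟨v, w, hw.ne, fun u hu x hxv hxu => ?_, htree, fun x a b ha hb => ?_⟩
  · obtain ⟨p, hp⟩ := hχ x v u hxv hxu
    cases p with
    | nil => exact absurd rfl hu
    | cons hadj q =>
      have := huniq _ hadj
      subst this
      exact hp _ (by simp)
  · obtain ⟨p, hp, -⟩ := htree.existsUnique_path a b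
    refine ⟨p, fun c hc => ?_⟩
    let f : T.induce {v}ᶜ ↪g T := SimpleGraph.Embedding.induce _
    have hfp : (p.map f.toHom).IsPath := hp.map f.injective
    refine (hχ x (f a) (f b) ha hb).mem_of_isPath hT.isAcyclic _ hfp (c := f c) ?_
    rw [SimpleGraph.Walk.support_map]
    exact List.mem_map.2 ⟨c, hc, rfl⟩

lemma IsTreeDecomp.exists_runningIntersection {ι : Type*} [Finite ι] {T : SimpleGraph ι}
    {χ : ι → Finset ℕ} (h : IsTreeDecomp T χ) :
    ∃ l, RunningIntersection l ∧ ∀ e, e ∈ l ↔ ∃ i, χ i = e := by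
  induction hn : Nat.card ι using Nat.strong_induction_on generalizing ι with
  | _ n ih =>
    have hne : Nonempty ι := h.1.1.nonempty
    rcases subsingleton_or_nontrivial ι with hs | hs
    · obtain ⟨i⟩ := hne
      refine ⟨[χ i], .single _, fun e => ?_⟩
      rw [List.mem_singleton]
      exact ⟨fun h => ⟨i, h.symm⟩, fun ⟨j, hj⟩ => by rw [← hj, Subsingleton.elim i j]⟩
    · obtain ⟨v, w, hvw, hleaf, hrest⟩ := isTreeDecomp_induce_leaf h
      have hlt : Nat.card ({v}ᶜ : Set ι) < n := by
        rw [← hn]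
        exact Finite.card_subtype_lt (x := v) (by simp)
      obtain ⟨l, hl, hmem⟩ := ih _ hlt hrest rfl
      refine ⟨χ v :: l, .cons _ (χ w) _ hl ((hmem _).2 ⟨⟨w, by simpa using hvw.symm⟩, rfl⟩)
        fun x hx g hg hxg => ?_, fun e => ?_⟩
      · obtain ⟨u, rfl⟩ := (hmem g).1 hg
        exact hleaf u.1 u.2 x hx hxg
      · rw [List.mem_cons, hmem]
        constructor
        · rintro (rfl | ⟨i, rfl⟩)
          · exact ⟨v, rfl⟩
          · exact ⟨i.1, rfl⟩
        · rintro ⟨i, rfl⟩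
          by_cases hi : i = v
          · exact .inl (by rw [hi])
          · exact .inr ⟨⟨i, hi⟩, rfl⟩

lemma isTree_of_leaf {ι : Type*} [Finite ι] {H : SimpleGraph ι} {v w : ι}
    (h : (H.induce {v}ᶜ).IsTree) (hw : H.Adj v w) (huniq : ∀ u, H.Adj v u → u = w) :
    H.IsTree := by
  classical
  have := Fintype.ofFinite ι
  have hreach : ∀ u, H.Reachable u w := by
    intro u
    by_cases hu : u = v
    · subst hu
      exact hw.reachable
    · exact (h.1.preconnected ⟨u, hu⟩ ⟨w, hw.ne.symm⟩).map
        (SimpleGraph.Embedding.induce _).toHom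
  have hconn : H.Connected :=
    { preconnected := fun a b => (hreach a).trans (hreach b).symm, nonempty := ⟨v⟩ }
  rw [SimpleGraph.isTree_iff_connected_and_card]
  refine ⟨hconn, ?_⟩
  have h1 := h.card_edgeFinset
  have hdeg : H.degree v = 1 :=
    SimpleGraph.degree_eq_one_iff_existsUnique_adj.2 ⟨w, hw, huniq⟩
  have h2 := H.card_edgeFinset_induce_compl_singleton v
  have h3 : Fintype.card ({v}ᶜ : Set ι) = Fintype.card ι - 1 := by
    rw [Fintype.card_compl_set]; simp
  have h4 : H.degree v ≤ H.edgeFinset.card := SimpleGraph.degree_le_card_edgeFinset (G := H) v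
  have h5 : 0 < Fintype.card ι := Fintype.card_pos_iff.2 ⟨v⟩
  rw [SimpleGraph.card_edgeFinset_deleteIncidenceSet, hdeg] at h2
  rw [hdeg] at h4
  simp only [SimpleGraph.edgeFinset_card, ← Nat.card_eq_fintype_card] at h1 h2 h3 h4 h5
  omega

/-- Attaching an atom as a leaf of a join tree. -/
lemma hasJoinTree_insert {B : Finset Atom} {A P : Atom} (h : hasJoinTree B) (hA : A ∉ B)
    (hP : P ∈ B) (hAP : ∀ x ∈ A.vars, ∀ C ∈ B, x ∈ C.vars → x ∈ P.vars) :
    hasJoinTree (insert A B) := by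
  obtain ⟨T, hT⟩ := h
  rw [joinTreeProp_iff] at hT
  obtain ⟨htree, hT⟩ := hT
  have hPA : P ≠ A := fun h => hA (h ▸ hP)
  let H : SimpleGraph {C : Atom // C ∈ insert A B} :=
    { Adj := fun x y => (∃ hx hy, T.Adj ⟨x.1, hx⟩ ⟨y.1, hy⟩) ∨ (x.1 = A ∧ y.1 = P) ∨
        (x.1 = P ∧ y.1 = A)
      symm := ⟨by
        rintro x y (⟨hx, hy, h⟩ | h | h)
        · exact .inl ⟨hy, hx, h.symm⟩
        · exact .inr (.inr h.symm)
        · exact .inr (.inl h.symm)⟩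
      loopless := ⟨by
        rintro x (⟨hx, hy, h⟩ | h | h)
        · exact h.ne rfl
        · exact hPA (h.2.symm.trans h.1)
        · exact hPA (h.1.symm.trans h.2)⟩ }
  let v : {C : Atom // C ∈ insert A B} := ⟨A, Finset.mem_insert_self _ _⟩
  let inc : {C : Atom // C ∈ B} → {C : Atom // C ∈ insert A B} :=
    fun C => ⟨C.1, Finset.mem_insert_of_mem C.2⟩
  let f : T →g H := ⟨inc, fun {a b} hab => .inl ⟨a.2, b.2, hab⟩⟩
  have hvw : H.Adj v (inc ⟨P, hP⟩) := .inr (.inl ⟨rfl, rfl⟩)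
  have hne : ∀ C : {C : Atom // C ∈ B}, inc C ≠ v := fun C h =>
    by
    have hCA : C.1 = A := congrArg Subtype.val h
    exact hA (hCA ▸ C.2)
  have hback : ∀ C : {C : Atom // C ∈ insert A B}, C ≠ v → C.1 ∈ B := fun C h =>
    (Finset.mem_insert.1 C.2).resolve_left fun h' => h (Subtype.ext h')
  have hiso : Nonempty (T ≃g H.induce {v}ᶜ) := by
    refine ⟨⟨⟨fun C => ⟨inc C, hne C⟩, fun C => ⟨C.1.1, hback C.1 C.2⟩, fun C => rfl,
      fun C => rfl⟩, fun {a b} => ?_⟩⟩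
    change H.Adj (inc a) (inc b) ↔ T.Adj a b
    constructor
    · rintro (⟨hx, hy, h⟩ | h | h)
      · exact h
      · exact absurd (Subtype.ext h.1) (hne a)
      · exact absurd (Subtype.ext h.2) (hne b)
    · exact fun h => .inl ⟨a.2, b.2, h⟩
  obtain ⟨iso⟩ := hiso
  refine ⟨H, (joinTreeProp_iff _ _).2 ⟨isTree_of_leaf (iso.isTree_iff.1 htree) hvw ?_, ?_⟩⟩
  · rintro u (⟨hx, -⟩ | h | h)
    · exact absurd hx hA
    · exact Subtype.ext h.2
    · exact absurd h.1.symm hPA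
  · intro x
    have old : ∀ a b : {C : Atom // C ∈ B}, x ∈ a.1.vars → x ∈ b.1.vars →
        WalkIn H {i | x ∈ i.1.vars} (inc a) (inc b) := fun a b ha hb =>
      (hT x a b ha hb).map f fun i hi => hi
    have new : ∀ b : {C : Atom // C ∈ B}, x ∈ A.vars → x ∈ b.1.vars →
        WalkIn H {i | x ∈ i.1.vars} v (inc b) := fun b ha hb =>
      (WalkIn.of_adj hvw ha (hAP x ha b.1 b.2 hb)).trans
        (old ⟨P, hP⟩ b (hAP x ha b.1 b.2 hb) hb)
    intro a b ha hb
    by_cases h1 : a = v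
    · subst h1
      by_cases h2 : b = v
      · subst h2
        exact .refl ha
      · exact new ⟨b.1, hback b h2⟩ ha hb
    · by_cases h2 : b = v
      · subst h2
        exact (new ⟨a.1, hback a h1⟩ hb ha).symm
      · exact old ⟨a.1, hback a h1⟩ ⟨b.1, hback b h2⟩ ha hb

lemma hasJoinTree_singleton (A : Atom) : hasJoinTree {A} := by
  have hsub : Subsingleton {C : Atom // C ∈ ({A} : Finset Atom)} :=
    ⟨fun a b => Subtype.ext
      ((Finset.mem_singleton.1 a.2).trans (Finset.mem_singleton.1 b.2).symm)⟩
  have hne : Nonempty {C : Atom // C ∈ ({A} : Finset Atom)} := ⟨⟨A, by simp⟩⟩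
  refine ⟨⊥, (joinTreeProp_iff _ _).2 ⟨SimpleGraph.IsTree.of_subsingleton, fun x a b ha hb => ?_⟩⟩
  rw [Subsingleton.elim b a]
  exact .refl ha

/-- A join tree extends to further atoms whose variables all occur in one atom of the tree. -/
lemma hasJoinTree_of_subset {B' B : Finset Atom} {P : Atom} (h : hasJoinTree B') (hB : B' ⊆ B)
    (hP : P ∈ B') (hcover : ∀ A ∈ B, A ∉ B' → A.vars ⊆ P.vars) : hasJoinTree B := by
  have key : ∀ S : Finset Atom, S ⊆ B → hasJoinTree (B' ∪ S) := by
    intro S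
    induction S using Finset.induction_on with
    | empty => simpa using h
    | insert A S hAS ih =>
      intro hS
      have ih' := ih fun C hC => hS (Finset.mem_insert_of_mem hC)
      rw [Finset.union_insert]
      by_cases hA : A ∈ B' ∪ S
      · rwa [Finset.insert_eq_of_mem hA]
      · refine hasJoinTree_insert ih' hA (Finset.mem_union_left _ hP) fun x hx _ _ _ => ?_
        exact hcover A (hS (Finset.mem_insert_self _ _))
          (fun h => hA (Finset.mem_union_left _ h)) hx
  have := key B subset_rfl
  rwa [Finset.union_eq_right.2 hB] at this

/-- Enlarging a member `f` by private elements preserves the running intersection property. -/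
lemma RunningIntersection.map_replace {l : List (Finset ℕ)} (h : RunningIntersection l)
    {e f : Finset ℕ} (hfe : f ⊆ e) (hpriv : ∀ x ∈ e, ∀ g ∈ l, x ∈ g → x ∈ f) :
    RunningIntersection (l.map fun g => if g = f then e else g) := by
  induction h with
  | single g => exact .single _
  | cons g g' l hl hg' hg ih =>
    have ih' := ih fun x hx k hk => hpriv x hx k (List.mem_cons_of_mem _ hk)
    rw [List.map_cons]
    have hle : ∀ k : Finset ℕ, k ⊆ if k = f then e else k := by
      intro k
      split_ifs with hk
      · rwa [hk]
      · exact subset_rfl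
    have hge : ∀ x ∈ g, ∀ k ∈ l, (x ∈ if k = f then e else k) → x ∈ k := by
      intro x hx k _ hxk
      split_ifs at hxk with hk
      · exact hk ▸ hpriv x hxk g List.mem_cons_self hx
      · exact hxk
    by_cases hgf : g = f
    · rw [if_pos hgf]
      by_cases hf : f ∈ l
      · exact .cons _ e _ ih' (List.mem_map.2 ⟨f, hf, by simp⟩) fun x hx _ _ _ => hx
      · refine .cons _ _ _ ih' (List.mem_map.2 ⟨g', hg', rfl⟩) fun x hx k hk hxk => ?_
        obtain ⟨k, hkl, rfl⟩ := List.mem_map.1 hk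
        have hkf : k ≠ f := fun h => hf (h ▸ hkl)
        rw [if_neg hkf] at hxk
        have hxg : x ∈ g := hgf ▸ hpriv x hx k (List.mem_cons_of_mem _ hkl) hxk
        exact hle _ (hg x hxg k hkl hxk)
    · rw [if_neg hgf]
      refine .cons _ _ _ ih' (List.mem_map.2 ⟨g', hg', rfl⟩) fun x hx k hk hxk => ?_
      obtain ⟨k, hkl, rfl⟩ := List.mem_map.1 hk
      exact hle _ (hg x hx k hkl (hge x hx k hkl hxk))

lemma hasJoinTree_of_runningIntersection {l : List (Finset ℕ)} (h : RunningIntersection l)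
    {B : Finset Atom} (hcover : ∀ A ∈ B, ∃ e ∈ l, A.vars ⊆ e)
    (hguard : ∀ e ∈ l, ∃ A ∈ B, e ⊆ A.vars) : hasJoinTree B := by
  classical
  induction hn : l.length generalizing l B with
  | zero =>
    rw [List.length_eq_zero_iff] at hn
    subst hn
    cases h
  | succ n ih =>
    cases h with
    | single e =>
      obtain ⟨A, hA, hAe⟩ := hguard e (by simp)
      refine hasJoinTree_of_subset (hasJoinTree_singleton A) (by simpa using hA)
        (Finset.mem_singleton_self A) fun C hC _ => ?_
      obtain ⟨e', he', hCe⟩ := hcover C hC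
      rw [List.mem_singleton.1 he'] at hCe
      exact hCe.trans hAe
    | cons e f l hl hf hef =>
      have hlen : l.length = n := by simpa using hn
      by_cases hfe : f ⊆ e
      · refine ih (hl.map_replace hfe hef) (fun A hA => ?_) (fun g hg => ?_) (by simpa using hlen)
        · obtain ⟨g, hg, hAg⟩ := hcover A hA
          rcases List.mem_cons.1 hg with rfl | hg
          · exact ⟨g, List.mem_map.2 ⟨f, hf, by simp⟩, hAg⟩
          · refine ⟨_, List.mem_map.2 ⟨g, hg, rfl⟩, ?_⟩
            split_ifs with hgf
            · exact hAg.trans (hgf ▸ hfe)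
            · exact hAg
        · obtain ⟨k, hk, rfl⟩ := List.mem_map.1 hg
          split_ifs with hkf
          · exact hguard e List.mem_cons_self
          · exact hguard k (List.mem_cons_of_mem _ hk)
      · let B' := B.filter fun A => ∃ g ∈ l, A.vars ⊆ g
        have hB' : B' ⊆ B := Finset.filter_subset _ _
        have hrest : ∀ A ∈ B, A ∉ B' → A.vars ⊆ e := by
          intro A hA hAB'
          obtain ⟨g, hg, hAg⟩ := hcover A hA
          rcases List.mem_cons.1 hg with rfl | hg
          · exact hAg
          · exact absurd (Finset.mem_filter.2 ⟨hA, g, hg, hAg⟩) hAB'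
        obtain ⟨Af, hAf, hfA⟩ := hguard f (List.mem_cons_of_mem _ hf)
        have hAfB' : Af ∈ B' := by
          by_contra hcon
          exact hfe (hfA.trans (hrest Af hAf hcon))
        have hjt : hasJoinTree B' := by
          refine ih hl (fun A hA => (Finset.mem_filter.1 hA).2) (fun g hg => ?_) hlen
          obtain ⟨A, hA, hgA⟩ := hguard g (List.mem_cons_of_mem _ hg)
          by_cases hAB' : A ∈ B'
          · exact ⟨A, hAB', hgA⟩
          · refine ⟨Af, hAfB', fun x hx => hfA ?_⟩
            exact hef x (hrest A hA hAB' (hgA hx)) g hg hx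
        obtain ⟨Ae, hAe, heA⟩ := hguard e List.mem_cons_self
        by_cases hAeB' : Ae ∈ B'
        · exact hasJoinTree_of_subset hjt hB' hAeB' fun A hA hAB' => (hrest A hA hAB').trans heA
        · refine hasJoinTree_of_subset (hasJoinTree_insert hjt hAeB' hAfB' ?_)
            (Finset.insert_subset hAe hB') (Finset.mem_insert_self _ _) fun A hA hAB' =>
            (hrest A hA fun h => hAB' (Finset.mem_insert_of_mem h)).trans heA
          intro x hx C hC hxC
          obtain ⟨-, g, hg, hCg⟩ := Finset.mem_filter.1 hC
          exact hfA (hef x (hrest Ae hAe hAeB' hx) g hg (hCg hxC))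

/-- A tree decomposition whose bags cover, and are covered by, the atoms of `B` yields a join
tree of `B`. -/
lemma hasJoinTree_of_isTreeDecomp {ι : Type*} [Finite ι] {T : SimpleGraph ι} {χ : ι → Finset ℕ}
    (h : IsTreeDecomp T χ) {B : Finset Atom} (hcover : ∀ A ∈ B, ∃ i, A.vars ⊆ χ i)
    (hguard : ∀ i, ∃ A ∈ B, χ i ⊆ A.vars) : hasJoinTree B := by
  obtain ⟨l, hl, hmem⟩ := h.exists_runningIntersection
  refine hasJoinTree_of_runningIntersection hl (fun A hA => ?_) fun e he => ?_
  · obtain ⟨i, hi⟩ := hcover A hA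
    exact ⟨χ i, (hmem _).2 ⟨i, rfl⟩, hi⟩
  · obtain ⟨i, rfl⟩ := (hmem e).1 he
    exact hguard i

lemma mem_vars_mapAtom {f : ℕ → ℕ} {A : Atom} {z : ℕ} :
    z ∈ (mapAtom f A).vars ↔ ∃ x ∈ A.vars, f x = z := by
  simp [mapAtom, Atom.vars]

lemma mem_varsOf {B : Finset Atom} {x : ℕ} : x ∈ varsOf B ↔ ∃ A ∈ B, x ∈ A.vars := by
  simp [varsOf]

lemma mapAtom_mapAtom (f g : ℕ → ℕ) (A : Atom) : mapAtom f (mapAtom g A) = mapAtom (f ∘ g) A := by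
  simp [mapAtom]

lemma mapAtom_congr {f g : ℕ → ℕ} {A : Atom} (h : ∀ x ∈ A.vars, f x = g x) :
    mapAtom f A = mapAtom g A := by
  simp only [mapAtom, Atom.mk.injEq, true_and]
  exact List.map_congr_left fun x hx => h x (List.mem_toFinset.2 hx)

lemma mapAtom_id (A : Atom) : mapAtom id A = A := by
  simp [mapAtom]

lemma eq_of_mapAtom_eq {f g : ℕ → ℕ} {A : Atom} (h : mapAtom f A = mapAtom g A) {x : ℕ}
    (hx : x ∈ A.vars) : f x = g x := by
  simp only [mapAtom, Atom.mk.injEq, true_and] at h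
  exact List.map_inj_left.1 h x (List.mem_toFinset.1 hx)

lemma eq_self_of_mapAtom_eq {f : ℕ → ℕ} {A : Atom} (h : mapAtom f A = A) {x : ℕ}
    (hx : x ∈ A.vars) : f x = x :=
  eq_of_mapAtom_eq (g := id) (h.trans (mapAtom_id A).symm) hx

lemma mapAtom_iterate {B : Finset Atom} {f : ℕ → ℕ} (h : ∀ A ∈ B, mapAtom f A ∈ B) (n : ℕ) :
    ∀ A ∈ B, mapAtom f^[n] A ∈ B := by
  induction n with
  | zero => intro A hA; rwa [Function.iterate_zero, mapAtom_id]
  | succ n ih =>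
    intro A hA
    rw [Function.iterate_succ, ← mapAtom_mapAtom]
    exact ih _ (h A hA)

/-- Retracts of acyclic atom sets are acyclic. -/
lemma hasJoinTree_of_retract {B C : Finset Atom} (h : hasJoinTree B) (hCB : C ⊆ B) {r : ℕ → ℕ}
    (hr : ∀ A ∈ B, mapAtom r A ∈ C) (hid : ∀ x ∈ varsOf C, r x = x) : hasJoinTree C := by
  obtain ⟨T, hT⟩ := h
  rw [joinTreeProp_iff] at hT
  have hdec : IsTreeDecomp T (fun A => A.1.vars ∩ varsOf C) := by
    refine ⟨hT.1, fun x a b ha hb => ?_⟩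
    rw [Finset.mem_inter] at ha hb
    exact (hT.2 x a b ha.1 hb.1).mono fun i hi =>
      show x ∈ i.1.vars ∩ varsOf C from Finset.mem_inter.2 ⟨hi, ha.2⟩
  refine hasJoinTree_of_isTreeDecomp hdec (fun A hA => ⟨⟨A, hCB hA⟩, fun x hx => ?_⟩) fun i =>
    ⟨mapAtom r i.1, hr i.1 i.2, fun x hx => ?_⟩
  · exact Finset.mem_inter.2 ⟨hx, mem_varsOf.2 ⟨A, hA, hx⟩⟩
  · rw [Finset.mem_inter] at hx
    exact mem_vars_mapAtom.2 ⟨x, hx.1, hid x hx.2⟩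

lemma exists_iterate_eq_self {W : Finset ℕ} {f : ℕ → ℕ} (hmaps : ∀ x ∈ W, f x ∈ W)
    (hinj : Set.InjOn f W) : ∃ n, ∀ x ∈ W, f^[n + 1] x = x := by
  let g : W → W := fun x => ⟨f x, hmaps x x.2⟩
  have hg : Function.Injective g := fun a b hab =>
    Subtype.ext (hinj a.2 b.2 (congrArg Subtype.val hab))
  have hgf : ∀ n (x : W), (g^[n] x : ℕ) = f^[n] x := by
    intro n
    induction n with
    | zero => intro x; rfl
    | succ n ih => intro x; rw [Function.iterate_succ_apply, ih, Function.iterate_succ_apply]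
  let e : Equiv.Perm W := Equiv.ofBijective g (Finite.injective_iff_bijective.1 hg)
  have hpos := orderOf_pos e
  refine ⟨orderOf e - 1, fun x hx => ?_⟩
  rw [Nat.sub_add_cancel hpos]
  have h1 : (e ^ orderOf e) ⟨x, hx⟩ = ⟨x, hx⟩ := by rw [pow_orderOf_eq_one]; rfl
  rw [Equiv.Perm.coe_pow] at h1
  have h2 := congrArg Subtype.val h1
  rwa [show (e : W → W) = g from rfl, hgf] at h2

/-- If `h x = t y` implies `k x = w y` for all variables `x` of `A` and `y` of `G`, then
equality of the images of `A` and `G` under `h` and `t` carries over to `k` and `w`. -/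
lemma mapAtom_eq_mapAtom_of_imp {A G : Atom} {h t k w : ℕ → ℕ} (hAG : mapAtom h A = mapAtom t G)
    (himp : ∀ x ∈ A.vars, ∀ y ∈ G.vars, h x = t y → k x = w y) :
    mapAtom k A = mapAtom w G := by
  obtain ⟨r, l⟩ := A
  obtain ⟨s, m⟩ := G
  simp only [mapAtom, Atom.mk.injEq, Atom.vars, List.mem_toFinset] at *
  refine ⟨hAG.1, ?_⟩
  have h2 := hAG.2
  clear hAG
  induction l generalizing m with
  | nil =>
    cases m with
    | nil => rfl
    | cons y m => simp at h2
  | cons x l ih =>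
    cases m with
    | nil => simp at h2
    | cons y m =>
      simp only [List.map_cons, List.cons.injEq] at h2 ⊢
      exact ⟨himp x (by simp) y (by simp) h2.1,
        ih m (fun x hx y hy => himp x (by simp [hx]) y (by simp [hy])) h2.2⟩

instance : Countable Atom :=
  Function.Injective.countable (f := fun A : Atom => (A.rel, A.args)) fun A B h => by
    cases A; cases B; simpa using h

lemma mem_viewDB {𝒱 : Finset CQ} {D : Database} {F : Atom} :
    F ∈ viewDB 𝒱 D ↔ ∃ V ∈ 𝒱, ∃ w : ℕ → ℕ, (∀ G ∈ V.body, mapAtom w G ∈ D) ∧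
      mapAtom w V.head = F := by
  simp [viewDB, evalCQ]

/-- Every endomorphism of `Q` fixing the head is injective on the variables. -/
def IsRigid (Q : CQ) : Prop :=
  ∀ g : ℕ → ℕ, (∀ A ∈ Q.body, mapAtom g A ∈ Q.body) → mapAtom g Q.head = Q.head →
    Set.InjOn g (varsOf Q.body)

lemma mapAtom_iterate_eq_self {f : ℕ → ℕ} {A : Atom} (h : mapAtom f A = A) (n : ℕ) :
    mapAtom f^[n] A = A := by
  induction n with
  | zero => rw [Function.iterate_zero, mapAtom_id]
  | succ n ih => rw [Function.iterate_succ, ← mapAtom_mapAtom, h, ih]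

lemma apply_mem_varsOf {B C : Finset Atom} {f : ℕ → ℕ} (h : ∀ A ∈ B, mapAtom f A ∈ C) {x : ℕ}
    (hx : x ∈ varsOf B) : f x ∈ varsOf C := by
  obtain ⟨A, hA, hxA⟩ := mem_varsOf.1 hx
  exact mem_varsOf.2 ⟨_, h A hA, mem_vars_mapAtom.2 ⟨x, hxA, rfl⟩⟩

lemma IsRigid.exists_iterate {Q : CQ} (hQ : IsRigid Q) {g : ℕ → ℕ}
    (hg : ∀ A ∈ Q.body, mapAtom g A ∈ Q.body) (hhead : mapAtom g Q.head = Q.head) :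
    ∃ n, ∀ x ∈ varsOf Q.body, g^[n + 1] x = x :=
  exists_iterate_eq_self (fun _ hx => apply_mem_varsOf hg hx) (hQ g hg hhead)

/-- Every conjunctive query retracts onto a rigid subquery with the same head. -/
lemma exists_rigid_retract (Q : CQ) :
    ∃ C ⊆ Q.body, IsRigid ⟨Q.head, C⟩ ∧ ∃ r : ℕ → ℕ, (∀ A ∈ Q.body, mapAtom r A ∈ C) ∧
      mapAtom r Q.head = Q.head ∧ ∀ x ∈ varsOf C, r x = x := by
  classical
  let P : Finset Atom → Prop := fun C =>
    ∃ f : ℕ → ℕ, (∀ A ∈ Q.body, mapAtom f A ∈ C) ∧ mapAtom f Q.head = Q.head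
  have hbody : Q.body ∈ Q.body.powerset.filter P :=
    Finset.mem_filter.2 ⟨by simp, id, fun A hA => by rwa [mapAtom_id], mapAtom_id _⟩
  obtain ⟨C, hC, hmin⟩ := Finset.exists_min_image (Q.body.powerset.filter P)
    (fun C => (varsOf C).card) ⟨_, hbody⟩
  obtain ⟨hCQ, f, hf, hfhead⟩ := Finset.mem_filter.1 hC
  rw [Finset.mem_powerset] at hCQ
  have hrigid : IsRigid ⟨Q.head, C⟩ := by
    intro g hg hghead
    have hsub : C.image (mapAtom g) ⊆ C := Finset.image_subset_iff.2 hg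
    have hvars : varsOf (C.image (mapAtom g)) = (varsOf C).image g := by
      ext z
      simp only [mem_varsOf, Finset.mem_image]
      constructor
      · rintro ⟨_, ⟨A, hA, rfl⟩, hz⟩
        obtain ⟨x, hx, rfl⟩ := mem_vars_mapAtom.1 hz
        exact ⟨x, ⟨A, hA, hx⟩, rfl⟩
      · rintro ⟨x, ⟨A, hA, hx⟩, rfl⟩
        exact ⟨_, ⟨A, hA, rfl⟩, mem_vars_mapAtom.2 ⟨x, hx, rfl⟩⟩
    have hle := hmin (C.image (mapAtom g)) (Finset.mem_filter.2
      ⟨Finset.mem_powerset.2 (hsub.trans hCQ), g ∘ f,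
        fun A hA => by
          rw [← mapAtom_mapAtom]
          exact Finset.mem_image_of_mem _ (hf A hA),
        by rw [← mapAtom_mapAtom, hfhead]; exact hghead⟩)
    rw [hvars] at hle
    exact Finset.card_image_iff.1 (le_antisymm Finset.card_image_le hle)
  have hfC : ∀ A ∈ C, mapAtom f A ∈ C := fun A hA => hf A (hCQ hA)
  obtain ⟨n, hn⟩ := hrigid.exists_iterate hfC hfhead
  refine ⟨C, hCQ, hrigid, f^[n + 1], fun A hA => ?_, mapAtom_iterate_eq_self hfhead _, hn⟩
  rw [Function.iterate_succ, ← mapAtom_mapAtom]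
  exact mapAtom_iterate hfC n _ (hf A hA)

/-- The substitution that freezes a view application: head variables go to the (frozen) values
of `m`, and the other variables become private values tagged with `i`. -/
def freeze (e : Option Atom × ℕ → ℕ) (V : CQ) (m : ℕ → ℕ) (i : Atom) (y : ℕ) : ℕ :=
  if y ∈ V.head.vars then e (none, m y) else e (some i, y)

/-- A rewriting `Q'` of `Q` yields view applications `V i`, `m i` mapping into the body of `Q`,
and a homomorphism from `Q` to the union of their frozen bodies. -/
lemma exists_hom_freeze {σ : Schema} {Q Q' : CQ} {𝒱 : Finset CQ} (hQ : isCQ σ Q)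
    (h𝒱 : isViewSet σ 𝒱) (hrw : isRewriting σ 𝒱 Q Q') {e : Option Atom × ℕ → ℕ} :
    ∃ (V : Atom → CQ) (m : Atom → ℕ → ℕ) (h : ℕ → ℕ),
      (∀ i ∈ Q'.body, V i ∈ 𝒱 ∧ ∀ G ∈ (V i).body, mapAtom (m i) G ∈ Q.body) ∧
      (∀ A ∈ Q.body, ∃ i ∈ Q'.body, ∃ G ∈ (V i).body,
        mapAtom h A = mapAtom (freeze e (V i) (m i) i) G) ∧
      ∀ x ∈ Q.head.vars, h x = e (none, x) := by
  classical
  obtain ⟨-, hover, -, -⟩ := hQ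
  obtain ⟨-, heval⟩ := hrw
  have hhead : Q.head ∈ evalCQ Q' (viewDB 𝒱 (Q.body : Set Atom)) := by
    rw [heval _ Q.body.finite_toSet fun F hF => hover F hF]
    exact ⟨id, fun A hA => by rwa [mapAtom_id], mapAtom_id _⟩
  obtain ⟨ν, hν, hνhead⟩ := hhead
  have hch : ∀ i, ∃ V m, i ∈ Q'.body → V ∈ 𝒱 ∧ (∀ G ∈ V.body, mapAtom m G ∈ Q.body) ∧
      mapAtom m V.head = mapAtom ν i := by
    intro i
    by_cases hi : i ∈ Q'.body
    · obtain ⟨V, hV, m, hm, hmi⟩ := mem_viewDB.1 (hν i hi)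
      exact ⟨V, m, fun _ => ⟨hV, hm, hmi⟩⟩
    · exact ⟨Q, id, fun h => absurd h hi⟩
  choose V m hVm using hch
  let D : Finset Atom := Q'.body.biUnion fun i => (V i).body.image (mapAtom (freeze e (V i) (m i) i))
  have hD : isDBOver σ (D : Set Atom) := by
    intro F hF
    obtain ⟨i, hi, hF⟩ := Finset.mem_biUnion.1 (Finset.mem_coe.1 hF)
    obtain ⟨G, hG, rfl⟩ := Finset.mem_image.1 hF
    have := (h𝒱.1 _ (hVm i hi).1).2.1 G hG
    exact ⟨this.1, by simpa [mapAtom] using this.2⟩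
  have hmem : mapAtom (fun x => e (none, x)) Q.head ∈ evalCQ Q' (viewDB 𝒱 (D : Set Atom)) := by
    refine ⟨(fun x => e (none, x)) ∘ ν, fun i hi => ?_, by rw [← mapAtom_mapAtom, hνhead]⟩
    refine mem_viewDB.2 ⟨V i, (hVm i hi).1, freeze e (V i) (m i) i, fun G hG => ?_, ?_⟩
    · exact Finset.mem_coe.2 (Finset.mem_biUnion.2 ⟨i, hi, Finset.mem_image_of_mem _ hG⟩)
    · rw [← mapAtom_mapAtom, ← (hVm i hi).2.2, mapAtom_mapAtom]
      exact mapAtom_congr fun x hx => if_pos hx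
  rw [heval _ D.finite_toSet hD] at hmem
  obtain ⟨h, hh, hhhead⟩ := hmem
  refine ⟨V, m, h, fun i hi => ⟨(hVm i hi).1, (hVm i hi).2.1⟩, fun A hA => ?_,
    fun x hx => eq_of_mapAtom_eq hhhead hx⟩
  obtain ⟨i, hi, hF⟩ := Finset.mem_biUnion.1 (Finset.mem_coe.1 (hh A hA))
  obtain ⟨G, hG, hGA⟩ := Finset.mem_image.1 hF
  exact ⟨i, hi, G, hG, hGA.symm⟩

/-- For rigid queries, the homomorphism of `exists_hom_freeze` can be chosen as a section of the
projection of the frozen view bodies to `Q`. -/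
lemma exists_section_freeze {σ : Schema} {Q Q' : CQ} {𝒱 : Finset CQ} (hQ : isCQ σ Q)
    (h𝒱 : isViewSet σ 𝒱) (hrw : isRewriting σ 𝒱 Q Q') (hrigid : IsRigid Q)
    {e : Option Atom × ℕ → ℕ} (he : Function.Injective e) :
    ∃ (V : Atom → CQ) (m : Atom → ℕ → ℕ) (h : ℕ → ℕ),
      (∀ i ∈ Q'.body, V i ∈ 𝒱 ∧ ∀ G ∈ (V i).body, mapAtom (m i) G ∈ Q.body) ∧
      (∀ A ∈ Q.body, ∃ i ∈ Q'.body, ∃ G ∈ (V i).body,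
        mapAtom h A = mapAtom (freeze e (V i) (m i) i) G) ∧
      (∀ x ∈ Q.head.vars, h x = e (none, x)) ∧
      ∀ x ∈ varsOf Q.body, ∀ v, h x = e (none, v) → x = v := by
  obtain ⟨V, m, h, hV, hbody, hhead⟩ := exists_hom_freeze hQ h𝒱 hrw (e := e)
  let val : Option Atom × ℕ → ℕ := fun q => q.1.elim q.2 fun i => m i q.2
  let g : ℕ → ℕ := fun x => val (Function.invFun e (h x))
  have hinv : ∀ q, Function.invFun e (e q) = q := Function.leftInverse_invFun he
  have hg : ∀ A ∈ Q.body, mapAtom g A ∈ Q.body := by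
    intro A hA
    obtain ⟨i, hi, G, hG, hAG⟩ := hbody A hA
    have : mapAtom g A = mapAtom (m i) G := by
      refine mapAtom_eq_mapAtom_of_imp hAG fun x _ y _ hxy => ?_
      simp only [g, hxy, freeze]
      split_ifs <;> simp [hinv, val]
    exact this ▸ (hV i hi).2 G hG
  have hghead : mapAtom g Q.head = Q.head := by
    conv_rhs => rw [← mapAtom_id Q.head]
    exact mapAtom_congr fun x hx => by simp [g, hhead x hx, hinv, val]
  obtain ⟨n, hn⟩ := hrigid.exists_iterate hg hghead
  refine ⟨V, m, h ∘ g^[n], hV, fun A hA => ?_, fun x hx => ?_, fun x hx v hxv => ?_⟩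
  · rw [← mapAtom_mapAtom]
    exact hbody _ (mapAtom_iterate hg n A hA)
  · rw [Function.comp_apply, eq_self_of_mapAtom_eq (mapAtom_iterate_eq_self hghead n) hx]
    exact hhead x hx
  · have h1 : g^[n + 1] x = v := by
      rw [Function.iterate_succ_apply']
      simp only [Function.comp_apply] at hxv
      simp [g, hxv, hinv, val]
    exact (hn x hx).symm.trans h1

/-- Two atoms of `B` share a variable from `Z`. -/
def Shares (B : Finset Atom) (Z : Set ℕ) (A A' : Atom) : Prop :=
  A ∈ B ∧ A' ∈ B ∧ ∃ x ∈ Z, x ∈ A.vars ∧ x ∈ A'.vars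

lemma eq_or_mem_of_eqvGen_shares {B : Finset Atom} {Z : Set ℕ} {A A' : Atom}
    (h : Relation.EqvGen (Shares B Z) A A') : A = A' ∨ (A ∈ B ∧ A' ∈ B) := by
  induction h with
  | rel A A' h => exact .inr ⟨h.1, h.2.1⟩
  | refl A => exact .inl rfl
  | symm A A' _ ih => exact ih.imp Eq.symm And.symm
  | trans A A' A'' _ _ ih ih' =>
    rcases ih with rfl | ih
    · exact ih'
    · rcases ih' with rfl | ih'
      · exact .inr ih
      · exact .inr ⟨ih.1, ih'.2⟩

lemma walkIn_class {N B : Finset Atom} {Z : Set ℕ} (hBN : B ⊆ N)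
    (hZ : ∀ A ∈ N, ∀ x ∈ A.vars, x ∈ Z → A ∈ B) {T : SimpleGraph {A : Atom // A ∈ N}}
    (hT : IsTreeDecomp T fun A => A.1.vars) (a b : {A : Atom // A ∈ N})
    (h : Quot.mk (Shares B Z) a.1 = Quot.mk (Shares B Z) b.1) :
    WalkIn T {i | Quot.mk (Shares B Z) i.1 = Quot.mk (Shares B Z) a.1} a b := by
  have key : ∀ A A' : Atom, Relation.EqvGen (Shares B Z) A A' → ∀ (hA : A ∈ N) (hA' : A' ∈ N),
      WalkIn T {i | Quot.mk (Shares B Z) i.1 = Quot.mk (Shares B Z) A} ⟨A, hA⟩ ⟨A', hA'⟩ := by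
    intro A A' h
    induction h with
    | rel A A' h =>
      intro hA hA'
      obtain ⟨hAB, -, x, hx, hxA, hxA'⟩ := h
      refine (hT.2 x ⟨A, hA⟩ ⟨A', hA'⟩ hxA hxA').mono fun i hi => ?_
      exact Quot.sound ⟨hZ i.1 i.2 x hi hx, hAB, x, hx, hi, hxA⟩
    | refl A => exact fun hA _ => .refl rfl
    | symm A A' h ih =>
      intro hA hA'
      exact (ih hA' hA).symm.mono fun i hi => Eq.trans hi (Quot.eqvGen_sound h)
    | trans A A' A'' h h' ih ih' =>
      intro hA hA''
      have hA' : A' ∈ N := by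
        rcases eq_or_mem_of_eqvGen_shares h with rfl | hmem
        · exact hA
        · exact hBN hmem.2
      exact (ih hA hA').trans ((ih' hA' hA'').mono fun i hi =>
        Eq.trans hi (Quot.eqvGen_sound h).symm)
  exact key a.1 b.1 (Quot.eqvGen_exact h) a.2 b.2

/-- Replacing atoms by atoms `ρ A` that depend only on the sharing class of `A` preserves
acyclicity, provided every variable is either confined to one class, or still occurs where it
did and in no class where it did not. -/
lemma hasJoinTree_image_of_shares {N B : Finset Atom} {Z : Set ℕ} (hBN : B ⊆ N)
    (hZ : ∀ A ∈ N, ∀ x ∈ A.vars, x ∈ Z → A ∈ B) (hN : hasJoinTree N) {ρ : Atom → Atom}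
    (hρ : ∀ A ∈ N, ∀ A' ∈ N, Quot.mk (Shares B Z) A = Quot.mk (Shares B Z) A' → ρ A = ρ A')
    (hvar : ∀ x,
      (∀ A ∈ N, ∀ A' ∈ N, x ∈ (ρ A).vars → x ∈ (ρ A').vars →
        Quot.mk (Shares B Z) A = Quot.mk (Shares B Z) A') ∨
      ((∀ A ∈ N, x ∈ A.vars → x ∈ (ρ A).vars) ∧
        ∀ A ∈ N, x ∈ (ρ A).vars →
          ∃ A' ∈ N, Quot.mk (Shares B Z) A = Quot.mk (Shares B Z) A' ∧ x ∈ A'.vars)) :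
    hasJoinTree (N.image ρ) := by
  obtain ⟨T, hT⟩ := hN
  rw [joinTreeProp_iff] at hT
  have hwalk : ∀ x (a b : {A : Atom // A ∈ N}), x ∈ (ρ a.1).vars →
      Quot.mk (Shares B Z) a.1 = Quot.mk (Shares B Z) b.1 →
      WalkIn T {i | x ∈ (ρ i.1).vars} a b := fun x a b ha hab =>
    (walkIn_class hBN hZ hT a b hab).mono fun i hi => by
      change x ∈ (ρ i.1).vars
      rwa [hρ i.1 i.2 a.1 a.2 hi]
  have hdec : IsTreeDecomp T (fun A => (ρ A.1).vars) := by
    refine ⟨hT.1, fun x a b ha hb => ?_⟩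
    rcases hvar x with h | ⟨h, h'⟩
    · exact hwalk x a b ha (h a.1 a.2 b.1 b.2 ha hb)
    · obtain ⟨A, hA, haA, hxA⟩ := h' a.1 a.2 ha
      obtain ⟨A', hA', hbA', hxA'⟩ := h' b.1 b.2 hb
      exact ((hwalk x a ⟨A, hA⟩ ha haA).trans
        ((hT.2 x ⟨A, hA⟩ ⟨A', hA'⟩ hxA hxA').mono fun i hi => h i.1 i.2 hi)).trans
        (hwalk x b ⟨A', hA'⟩ hb hbA').symm
  refine hasJoinTree_of_isTreeDecomp hdec (fun C hC => ?_) fun i =>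
    ⟨ρ i.1, Finset.mem_image_of_mem _ i.2, subset_rfl⟩
  obtain ⟨A, hA, rfl⟩ := Finset.mem_image.1 hC
  exact ⟨⟨A, hA⟩, subset_rfl⟩

/-- The main theorem for rigid queries. -/
lemma exists_freeConnex_rewriting_of_isRigid {σ : Schema} {Q : CQ} {𝒱 : Finset CQ}
    (hQ : isCQ σ Q) (hfc : isFreeConnex Q) (h𝒱 : isViewSet σ 𝒱)
    (hfresh : ∀ V ∈ 𝒱, Q.head.rel ≠ V.head.rel) (hrigid : IsRigid Q)
    (hrw : ∃ Q', isRewriting σ 𝒱 Q Q') :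
    ∃ Q', isRewriting σ 𝒱 Q Q' ∧ isFreeConnex Q' := by
  classical
  obtain ⟨Q', hrw⟩ := hrw
  obtain ⟨e, he⟩ := Countable.exists_injective_nat (Option Atom × ℕ)
  obtain ⟨V, m, h, hV, hbody, hhead, hsec⟩ := exists_section_freeze hQ h𝒱 hrw hrigid he
  obtain ⟨hne, hover, hheadrel, hsafe⟩ := hQ
  have hch : ∀ A, ∃ i, A ∈ Q.body → i ∈ Q'.body ∧ ∃ G ∈ (V i).body,
      mapAtom h A = mapAtom (freeze e (V i) (m i) i) G := by
    intro A
    by_cases hA : A ∈ Q.body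
    · obtain ⟨i, hi⟩ := hbody A hA
      exact ⟨i, fun _ => hi⟩
    · exact ⟨A, fun h => absurd h hA⟩
  choose b hb using hch
  let Z : Set ℕ := {x | h x ≠ e (none, x)}
  let cls : Atom → Quot (Shares Q.body Z) := Quot.mk _
  have hvisible : ∀ A ∈ Q.body, ∀ x ∈ A.vars, x ∉ Z →
      ∃ y ∈ (V (b A)).head.vars, m (b A) y = x := by
    intro A hA x hx hxZ
    obtain ⟨-, G, hG, hAG⟩ := hb A hA
    obtain ⟨y, hy, hyx⟩ := mem_vars_mapAtom.1 (hAG ▸ mem_vars_mapAtom.2 ⟨x, hx, rfl⟩)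
    rw [not_not.1 hxZ, freeze] at hyx
    split_ifs at hyx with hyh
    · exact ⟨y, hyh, by simpa using he hyx⟩
    · simpa using he hyx
  have hhidden : ∀ A ∈ Q.body, ∀ x ∈ A.vars, x ∈ Z → ∃ y, h x = e (some (b A), y) := by
    intro A hA x hx hxZ
    obtain ⟨-, G, hG, hAG⟩ := hb A hA
    obtain ⟨y, hy, hyx⟩ := mem_vars_mapAtom.1 (hAG ▸ mem_vars_mapAtom.2 ⟨x, hx, rfl⟩)
    rw [freeze] at hyx
    split_ifs at hyx with hyh
    · have := hsec x (mem_varsOf.2 ⟨A, hA, hx⟩) _ hyx.symm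
      exact absurd (this ▸ hyx.symm) hxZ
    · exact ⟨y, hyx.symm⟩
  have hbshares : ∀ A A', Shares Q.body Z A A' → b A = b A' := by
    rintro A A' ⟨hA, hA', x, hxZ, hxA, hxA'⟩
    obtain ⟨y, hy⟩ := hhidden A hA x hxA hxZ
    obtain ⟨y', hy'⟩ := hhidden A' hA' x hxA' hxZ
    have := he (hy.symm.trans hy')
    simp only [Prod.mk.injEq, Option.some.injEq] at this
    exact this.1
  let bq : Quot (Shares Q.body Z) → Atom := Quot.lift b hbshares
  have hheadZ : ∀ x ∈ Q.head.vars, x ∉ Z := fun x hx => not_not.2 (hhead x hx)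
  have hheadB : Q.head ∉ Q.body := fun hmem => hheadrel (hover _ hmem).1
  -- Variables of view atoms that do not occur in the class are replaced by fresh ones.
  obtain ⟨c, hc⟩ := Countable.exists_injective_nat (Quot (Shares Q.body Z) × ℕ)
  let M : ℕ := (varsOf Q.body).sup id + 1
  let fresh : Quot (Shares Q.body Z) × ℕ → ℕ := fun q => c q + M
  have hfresh_inj : Function.Injective fresh := fun p q hpq => hc (Nat.add_right_cancel hpq)
  have hfresh_not : ∀ q, fresh q ∉ varsOf Q.body := by
    intro q hq
    have : id (fresh q) ≤ (varsOf Q.body).sup id := Finset.le_sup hq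
    simp only [id, fresh, M] at this
    omega
  let occurs : Quot (Shares Q.body Z) → ℕ → Prop := fun k v =>
    ∃ A ∈ Q.body, cls A = k ∧ v ∈ A.vars
  let γ : Quot (Shares Q.body Z) → ℕ → ℕ := fun k v => if occurs k v then v else fresh (k, v)
  let ρc : Quot (Shares Q.body Z) → Atom := fun k =>
    mapAtom (γ k ∘ m (bq k)) (V (bq k)).head
  have hclsV : ∀ A ∈ Q.body, V (bq (cls A)) ∈ 𝒱 := fun A hA => (hV _ (hb A hA).1).1
  have hρvis : ∀ A ∈ Q.body, ∀ x ∈ A.vars, x ∉ Z → x ∈ (ρc (cls A)).vars := by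
    intro A hA x hx hxZ
    obtain ⟨y, hy, hyx⟩ := hvisible A hA x hx hxZ
    refine mem_vars_mapAtom.2 ⟨y, hy, ?_⟩
    change γ (cls A) (m (b A) y) = x
    rw [hyx]
    exact if_pos ⟨A, hA, rfl, hx⟩
  have hρvars : ∀ k, ∀ z ∈ (ρc k).vars, occurs k z ∨ ∃ v, z = fresh (k, v) := by
    intro k z hz
    obtain ⟨y, -, rfl⟩ := mem_vars_mapAtom.1 hz
    simp only [Function.comp_apply, γ]
    split_ifs with hocc
    · exact .inl hocc
    · exact .inr ⟨_, rfl⟩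
  let R : CQ := ⟨Q.head, Q.body.image fun A => ρc (cls A)⟩
  have hRover : overViews 𝒱 R := by
    refine ⟨hne.image _, fun C hC => ?_, hfresh, fun x hx => ?_⟩
    · obtain ⟨A, hA, rfl⟩ := Finset.mem_image.1 hC
      exact ⟨_, hclsV A hA, rfl, by simp [ρc, mapAtom]⟩
    · obtain ⟨A, hA, hxA⟩ := mem_varsOf.1 (hsafe hx)
      exact mem_varsOf.2 ⟨_, Finset.mem_image_of_mem _ hA, hρvis A hA x hxA (hheadZ x hx)⟩
  have hsound : ∀ D : Database, evalCQ R (viewDB 𝒱 D) ⊆ evalCQ Q D := by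
    rintro D _ ⟨θ, hθ, rfl⟩
    have hw : ∀ k, ∃ w : ℕ → ℕ, (∃ A ∈ Q.body, cls A = k) →
        (∀ G ∈ (V (bq k)).body, mapAtom w G ∈ D) ∧
          mapAtom w (V (bq k)).head = mapAtom θ (ρc k) := by
      intro k
      by_cases hk : ∃ A ∈ Q.body, cls A = k
      · obtain ⟨A, hA, rfl⟩ := hk
        obtain ⟨U, hU, w, hw, hweq⟩ := mem_viewDB.1 (hθ _ (Finset.mem_image_of_mem _ hA))
        have hUV : U = V (bq (cls A)) := by
          by_contra hne
          refine h𝒱.2 U hU _ (hclsV A hA) hne ?_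
          simpa [mapAtom, ρc] using congrArg Atom.rel hweq
        subst hUV
        exact ⟨w, fun _ => ⟨hw, hweq⟩⟩
      · exact ⟨id, fun h => absurd h hk⟩
    choose w hw using hw
    have hlam : ∀ x, ∃ u, (x ∉ Z → u = θ x) ∧
        (x ∈ Z → ∀ A ∈ Q.body, x ∈ A.vars → ∀ y, h x = e (some (b A), y) → u = w (cls A) y) := by
      intro x
      by_cases hx : x ∈ Z
      · by_cases hA : ∃ A ∈ Q.body, x ∈ A.vars
        · obtain ⟨A, hA, hxA⟩ := hA
          obtain ⟨y, hy⟩ := hhidden A hA x hxA hx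
          refine ⟨w (cls A) y, fun h => absurd hx h, fun _ A' hA' hxA' y' hy' => ?_⟩
          have heq := he (hy.symm.trans hy')
          simp only [Prod.mk.injEq] at heq
          have hcls : cls A = cls A' := Quot.sound ⟨hA, hA', x, hx, hxA, hxA'⟩
          rw [heq.2, hcls]
        · exact ⟨0, fun h => absurd hx h, fun _ A hA' hxA => absurd ⟨A, hA', hxA⟩ hA⟩
      · exact ⟨θ x, fun _ => rfl, fun h => absurd h hx⟩
    choose lam hlamvis hlamhid using hlam
    refine ⟨lam, fun A hA => ?_, mapAtom_congr fun x hx => hlamvis x (hheadZ x hx)⟩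
    obtain ⟨-, G, hG, hAG⟩ := hb A hA
    obtain ⟨hwbody, hwhead⟩ := hw (cls A) ⟨A, hA, rfl⟩
    have : mapAtom lam A = mapAtom (w (cls A)) G := by
      refine mapAtom_eq_mapAtom_of_imp hAG fun x hx y hy hxy => ?_
      rw [freeze] at hxy
      split_ifs at hxy with hyh
      · have hxm : x = m (b A) y := hsec x (mem_varsOf.2 ⟨A, hA, hx⟩) _ hxy
        have hxZ : x ∉ Z := not_not.2 (by rw [hxy, ← hxm])
        rw [hlamvis x hxZ]
        rw [mapAtom_mapAtom] at hwhead
        have h1 := eq_of_mapAtom_eq hwhead hyh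
        rw [h1]
        change θ x = θ (γ (cls A) (m (b A) y))
        rw [← hxm]
        exact congrArg θ (if_pos ⟨A, hA, rfl, hx⟩ : γ (cls A) x = x).symm
      · have hxZ : x ∈ Z := fun hvis => by simpa using he (hxy.symm.trans hvis)
        exact hlamhid x hxZ A hA hx y hxy
    rw [this]
    exact hwbody G hG
  have hcomplete : ∀ D : Database, evalCQ Q D ⊆ evalCQ R (viewDB 𝒱 D) := by
    rintro D _ ⟨lam, hlam, rfl⟩
    have : Nonempty (Quot (Shares Q.body Z) × ℕ) := ⟨(cls Q.head, 0)⟩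
    let θ : ℕ → ℕ := fun z =>
      if z ∈ varsOf Q.body then lam z else lam (Function.invFun fresh z).2
    have hθγ : ∀ k v, θ (γ k v) = lam v := by
      intro k v
      simp only [γ]
      split_ifs with hocc
      · obtain ⟨A, hA, -, hv⟩ := hocc
        exact if_pos (mem_varsOf.2 ⟨A, hA, hv⟩)
      · simp only [θ]
        rw [if_neg (hfresh_not _), Function.leftInverse_invFun hfresh_inj]
    refine ⟨θ, fun C hC => ?_, mapAtom_congr fun x hx => if_pos (hsafe hx)⟩
    obtain ⟨A, hA, rfl⟩ := Finset.mem_image.1 hC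
    refine mem_viewDB.2 ⟨_, hclsV A hA, lam ∘ m (bq (cls A)), fun G hG => ?_, ?_⟩
    · rw [← mapAtom_mapAtom]
      exact hlam _ ((hV _ (hb A hA).1).2 G hG)
    · rw [mapAtom_mapAtom]
      exact mapAtom_congr fun x _ => (hθγ _ _).symm
  let ρ : Atom → Atom := fun A => if A = Q.head then A else ρc (cls A)
  have hρB : ∀ A ∈ Q.body, ρ A = ρc (cls A) := fun A hA => if_neg fun (hAh : A = Q.head) => hheadB (hAh ▸ hA)
  have hρhead : ρ Q.head = Q.head := if_pos rfl
  have hacyc : ∀ N : Finset Atom, Q.body ⊆ N → N ⊆ insert Q.head Q.body → hasJoinTree N →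
      hasJoinTree (N.image ρ) := by
    intro N hBN hNB hN
    have hcases : ∀ A ∈ N, A = Q.head ∨ A ∈ Q.body := fun A hA => Finset.mem_insert.1 (hNB hA)
    refine hasJoinTree_image_of_shares (Z := Z) hBN (fun A hA x hx hxZ => ?_) hN
      (fun A hA A' hA' hAA' => ?_) fun z => ?_
    · rcases hcases A hA with rfl | hA
      · exact absurd hxZ (hheadZ x hx)
      · exact hA
    · rcases eq_or_mem_of_eqvGen_shares (Quot.eqvGen_exact hAA') with rfl | ⟨hAB, hAB'⟩
      · rfl
      · rw [hρB A hAB, hρB A' hAB']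
        exact congrArg ρc hAA'
    · by_cases hz : z ∈ varsOf Q.body ∧ z ∉ Z
      · refine .inr ⟨fun A hA hzA => ?_, fun A hA hzA => ?_⟩
        · rcases hcases A hA with rfl | hA
          · rwa [hρhead]
          · rw [hρB A hA]
            exact hρvis A hA z hzA hz.2
        · rcases hcases A hA with rfl | hAB
          · rw [hρhead] at hzA
            exact ⟨_, hA, rfl, hzA⟩
          · rw [hρB A hAB] at hzA
            rcases hρvars _ z hzA with ⟨A', hA', hcls, hzA'⟩ | ⟨v, rfl⟩
            · exact ⟨A', hBN hA', hcls.symm, hzA'⟩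
            · exact absurd hz.1 (hfresh_not _)
      · have hzcase : ∀ A ∈ N, z ∈ (ρ A).vars →
            (z ∈ Z ∧ occurs (cls A) z) ∨ ∃ v, z = fresh (cls A, v) := by
          intro A hA hzA
          rcases hcases A hA with rfl | hAB
          · rw [hρhead] at hzA
            exact absurd ⟨hsafe hzA, hheadZ z hzA⟩ hz
          · rw [hρB A hAB] at hzA
            refine (hρvars _ z hzA).imp_left fun hocc => ⟨?_, hocc⟩
            obtain ⟨A', hA', -, hzA'⟩ := hocc
            by_contra hzZ
            exact hz ⟨mem_varsOf.2 ⟨A', hA', hzA'⟩, hzZ⟩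
        refine .inl fun A hA A' hA' hzA hzA' => ?_
        rcases hzcase A hA hzA with ⟨hzZ, A1, hA1, hcls1, hz1⟩ | ⟨v, hv⟩ <;>
          rcases hzcase A' hA' hzA' with ⟨hzZ', A2, hA2, hcls2, hz2⟩ | ⟨v', hv'⟩
        · exact (hcls1.symm.trans (Quot.sound ⟨hA1, hA2, z, hzZ, hz1, hz2⟩)).trans hcls2
        · exact absurd (mem_varsOf.2 ⟨A1, hA1, hz1⟩) (hv' ▸ hfresh_not _)
        · exact absurd (mem_varsOf.2 ⟨A2, hA2, hz2⟩) (hv ▸ hfresh_not _)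
        · exact congrArg Prod.fst (hfresh_inj (hv.symm.trans hv'))
  have himage : Q.body.image ρ = R.body := Finset.image_congr hρB
  refine ⟨R, ⟨hRover, fun D _ _ => (hsound D).antisymm (hcomplete D)⟩, ?_, ?_⟩
  · have := hacyc Q.body subset_rfl (Finset.subset_insert _ _) hfc.1
    rwa [himage] at this
  · have := hacyc _ (Finset.subset_insert _ _) subset_rfl hfc.2
    rwa [Finset.image_insert, himage, hρhead] at this

/-- If a free-connex acyclic CQ `Q` is 𝒱-rewritable, then there is a
free-connex acyclic 𝒱-rewriting of `Q`. -/
theorem statement5 (σ : Schema) (Q : CQ) (𝒱 : Finset CQ)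
    (hQ : isCQ σ Q) (hfc : isFreeConnex Q) (h𝒱 : isViewSet σ 𝒱)
    (hfresh : ∀ V ∈ 𝒱, Q.head.rel ≠ V.head.rel)
    (hrw : ∃ Q', isRewriting σ 𝒱 Q Q') :
    ∃ Q', isRewriting σ 𝒱 Q Q' ∧ isFreeConnex Q' := by
  obtain ⟨C, hCQ, hrigid, r, hr, hrhead, hrC⟩ := exists_rigid_retract Q
  have heval : ∀ D, evalCQ ⟨Q.head, C⟩ D = evalCQ Q D := by
    intro D
    ext F
    constructor
    · rintro ⟨ν, hν, rfl⟩
      refine ⟨ν ∘ r, fun A hA => ?_, ?_⟩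
      · rw [← mapAtom_mapAtom]
        exact hν _ (hr A hA)
      · rw [← mapAtom_mapAtom, hrhead]
    · rintro ⟨ν, hν, rfl⟩
      exact ⟨ν, fun A hA => hν A (hCQ hA), rfl⟩
  have hrewrite : ∀ Q', isRewriting σ 𝒱 ⟨Q.head, C⟩ Q' ↔ isRewriting σ 𝒱 Q Q' := fun Q' => by
    simp only [isRewriting, heval]
  obtain ⟨hne, hover, hheadrel, hsafe⟩ := hQ
  have hsafeC : Q.head.vars ⊆ varsOf C := fun x hx => by
    have := apply_mem_varsOf hr (hsafe hx)
    rwa [eq_self_of_mapAtom_eq hrhead hx] at this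
  have hCcq : isCQ σ ⟨Q.head, C⟩ :=
    ⟨hne.elim fun A hA => ⟨_, hr A hA⟩, fun A hA => hover A (hCQ hA), hheadrel, hsafeC⟩
  have hCfc : isFreeConnex ⟨Q.head, C⟩ := by
    refine ⟨hasJoinTree_of_retract hfc.1 hCQ hr hrC,
      hasJoinTree_of_retract (r := r) hfc.2 (Finset.insert_subset_insert _ hCQ) (fun A hA => ?_)
        fun x hx => ?_⟩
    · rcases Finset.mem_insert.1 hA with rfl | hA
      · rw [hrhead]
        exact Finset.mem_insert_self _ _
      · exact Finset.mem_insert_of_mem (hr A hA)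
    · obtain ⟨A, hA, hxA⟩ := mem_varsOf.1 hx
      rcases Finset.mem_insert.1 hA with rfl | hA
      · exact hrC x (hsafeC hxA)
      · exact hrC x (mem_varsOf.2 ⟨A, hA, hxA⟩)
  simp only [← hrewrite] at hrw ⊢
  exact exists_freeConnex_rewriting_of_isRigid hCcq hCfc h𝒱 hfresh hrigid hrw
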